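/- arXiv:2512.22314 — 2 statements merged into one kernel-verified Lean document; each statement's English description precedes it below -/
import Mathlib

section
/- Let V be a type, let α₀ < α be ordinals, and let f be a function from the ordinals to V. There exists an order isomorphism φ from Set.Ico (α₀ + 1) α onto Set.Ico α₀ α such that f β = f (φ β) for every β with α₀ + 1 ≤ β < α, if and only if both α₀ + ω ≤ α and f β = f α₀ for every ordinal β with α₀ ≤ β < α₀ + ω. -/
open Ordinal

/-- An order isomorphism from `[a + 1, b)` onto `[a, b)` lowers every finite translate of `a`
by one; in particular all these translates lie below `b`. -/
theorem exists_orderIso_Ico_add_natCast {a b : Ordinal} (h : a < b)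
    (φ : Set.Ico (a + 1) b ≃o Set.Ico a b) (n : ℕ) :
    ∃ β : Set.Ico (a + 1) b, β.1 = a + n + 1 ∧ (φ β).1 = a + n := by
  induction n with
  | zero =>
    have hψ := (φ.symm ⟨a, le_rfl, h⟩).2
    refine ⟨⟨a + 1, le_rfl, hψ.1.trans_lt hψ.2⟩, by simp, ?_⟩
    have hle : φ ⟨a + 1, le_rfl, hψ.1.trans_lt hψ.2⟩ ≤ ⟨a, le_rfl, h⟩ :=
      φ.le_symm_apply.1 hψ.1
    simpa using congrArg Subtype.val (le_antisymm hle (φ _).2.1)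
  | succ n ih =>
    obtain ⟨β, hβ, hφ⟩ := ih
    have hβ' : a + (n + 1 : ℕ) = β.1 := by rw [hβ, Nat.cast_add_one, add_assoc]
    have hmem : β.1 ∈ Set.Ico a b := ⟨le_self_add.trans β.2.1, β.2.2⟩
    have hlt : β < φ.symm ⟨β.1, hmem⟩ := by
      rw [φ.lt_symm_apply, ← Subtype.coe_lt_coe, hφ]
      exact (lt_add_one _).trans_eq hβ.symm
    have hle : β.1 + 1 ≤ (φ.symm ⟨β.1, hmem⟩).1 := Order.add_one_le_of_lt hlt
    have hmem' : β.1 + 1 ∈ Set.Ico (a + 1) b :=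
      ⟨β.2.1.trans le_self_add, hle.trans_lt (φ.symm _).2.2⟩
    have hφ_le : φ ⟨β.1 + 1, hmem'⟩ ≤ ⟨β.1, hmem⟩ := φ.le_symm_apply.1 hle
    have hφ_lt : φ β < φ ⟨β.1 + 1, hmem'⟩ := φ.lt_iff_lt.2 (lt_add_one β.1)
    rw [hβ']
    refine ⟨⟨β.1 + 1, hmem'⟩, rfl, le_antisymm hφ_le ?_⟩
    exact (hβ.trans (by rw [hφ])).trans_le (Order.add_one_le_of_lt hφ_lt)

/-- If `a + ω ≤ b`, then `a + 1 + x ↦ a + x` is an order isomorphism from `[a + 1, b)`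
onto `[a, b)`. -/
noncomputable def Ordinal.icoAddOneOrderIso {a b : Ordinal} (h : a + ω ≤ b) :
    Set.Ico (a + 1) b ≃o Set.Ico a b :=
  have hb : a + 1 + (b - a) = b := by
    rw [add_assoc, one_add_of_omega0_le (le_sub_of_add_le h),
      Ordinal.add_sub_cancel_of_le (le_self_add.trans h)]
  { toFun β := ⟨a + (β.1 - (a + 1)), le_self_add, by
      refine lt_of_le_of_lt ?_ β.2.2
      conv_rhs => rw [← Ordinal.add_sub_cancel_of_le β.2.1]
      gcongr
      exact le_self_add⟩
    invFun γ := ⟨a + 1 + (γ.1 - a), le_self_add, by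
      conv_rhs => rw [← hb]
      gcongr
      rw [sub_lt_of_le γ.2.1, Ordinal.add_sub_cancel_of_le (le_self_add.trans h)]
      exact γ.2.2⟩
    left_inv β := Subtype.ext <| by
      simp only [Ordinal.add_sub_cancel, Ordinal.add_sub_cancel_of_le β.2.1]
    right_inv γ := Subtype.ext <| by
      simp only [Ordinal.add_sub_cancel, Ordinal.add_sub_cancel_of_le γ.2.1]
    map_rel_iff' {β γ} := by
      change a + (β.1 - (a + 1)) ≤ a + (γ.1 - (a + 1)) ↔ β.1 ≤ γ.1
      rw [add_le_add_iff_left, sub_le, Ordinal.add_sub_cancel_of_le γ.2.1] }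

/-- Criterion for a skand to be reflexive, in terms of its associated counting
function `f`: the part on `[α₀+1, α)` equals the whole skand on `[α₀, α)` iff
`α₀ + ω ≤ α` and `f` is constantly `f α₀` on `[α₀, α₀ + ω)`. -/
theorem reflexive_skand_criterion {V : Type*} (α₀ α : Ordinal) (h : α₀ < α)
    (f : Ordinal → V) :
    (∃ φ : Set.Ico (α₀ + 1) α ≃o Set.Ico α₀ α,
        ∀ β : Set.Ico (α₀ + 1) α, f β.1 = f (φ β).1) ↔
      (α₀ + ω ≤ α ∧ ∀ β : Ordinal, α₀ ≤ β → β < α₀ + ω → f β = f α₀) := by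
  constructor
  · rintro ⟨φ, hf⟩
    have key := exists_orderIso_Ico_add_natCast h φ
    constructor
    · rw [← le_sub_of_le h.le, omega0_le]
      intro n
      obtain ⟨β, hβ, -⟩ := key n
      rw [le_sub_of_le h.le]
      exact (le_self_add.trans hβ.ge).trans β.2.2.le
    · intro β hβ hlt
      obtain ⟨n, hn⟩ := lt_omega0.1 ((sub_lt_of_le hβ).2 hlt)
      rw [← Ordinal.add_sub_cancel_of_le hβ, hn]
      clear hn
      induction n with
      | zero => simp
      | succ n ih =>
        obtain ⟨γ, hγ, hφ⟩ := key n
        rw [Nat.cast_add_one, ← add_assoc, ← hγ, hf, hφ, ih]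
  · rintro ⟨hω, hf⟩
    refine ⟨icoAddOneOrderIso hω, fun β => ?_⟩
    change f β.1 = f (α₀ + (β.1 - (α₀ + 1)))
    obtain ⟨x, hx⟩ : ∃ x, β.1 = α₀ + 1 + x := ⟨_, (Ordinal.add_sub_cancel_of_le β.2.1).symm⟩
    rw [hx, Ordinal.add_sub_cancel, add_assoc]
    rcases lt_or_ge x ω with hlt | hge
    · rw [hf (α₀ + x) le_self_add (by gcongr), hf _ le_self_add]
      rw [← one_add_omega0]
      gcongr
    · rw [one_add_of_omega0_le hge]
end

section
/- Let V be a type, let α₀ and α be ordinals with α₀ + ω ≤ α, and let f be a function from the ordinals to V. The following are equivalent: (1) for every ordinal α' with α₀ < α' < α there exists an order isomorphism φ from Set.Ico α' α onto Set.Ico α₀ α such that f β = f (φ β) for every β with α' ≤ β < α; (2) there exists an ordinal κ > 0 with α = α₀ + ω ^ κ, and f β = f α₀ for every ordinal β with α₀ ≤ β < α. -/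
open Ordinal

namespace Ordinal

/-- Left translation by `a` as an order isomorphism from `[0, c)` onto `[a, a + c)`. -/
noncomputable def iioOrderIsoIcoAdd (a c : Ordinal) : Set.Iio c ≃o Set.Ico a (a + c) where
  toFun x := ⟨a + x.1, le_self_add, add_lt_add_right x.2 a⟩
  invFun y := ⟨y.1 - a, Ordinal.sub_lt_of_le y.2.1 |>.2 y.2.2⟩
  left_inv x := Subtype.ext (add_sub_cancel a x.1)
  right_inv y := Subtype.ext (Ordinal.add_sub_cancel_of_le y.2.1)
  map_rel_iff' := by
    intro x y
    exact add_le_add_iff_left a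

theorem eq_of_iio_orderIso {β : Type*} [LinearOrder β] [WellFoundedLT β] {b c : β}
    (e : Set.Iio b ≃o Set.Iio c) : b = c :=
  (typein_inj LT.lt).1 e.toRelIsoLT.ordinalType_congr

end Ordinal

/-- An order isomorphism between half-open intervals sends the left endpoint to the left
endpoint. -/
theorem OrderIso.apply_left_Ico {β : Type*} [PartialOrder β] {a b c d : β}
    (φ : Set.Ico a b ≃o Set.Ico c d) (hab : a < b) (hcd : c < d) :
    (φ ⟨a, le_rfl, hab⟩).1 = c := by
  refine le_antisymm ?_ (φ _).2.1
  have h : φ ⟨a, le_rfl, hab⟩ ≤ ⟨c, le_rfl, hcd⟩ :=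
    φ.le_symm_apply.1 (φ.symm ⟨c, le_rfl, hcd⟩).2.1
  exact h

/-- Criterion for an infinite skand to be self-similar, in terms of its
associated counting function `f`: every remainder on `[α', α)` equals the whole
skand on `[α₀, α)` iff `α = α₀ + ω ^ κ` for some `κ > 0` and `f` is constantly
`f α₀` on `[α₀, α)`. -/
theorem selfSimilar_skand_criterion {V : Type*} (α₀ α : Ordinal)
    (h : α₀ + ω ≤ α) (f : Ordinal → V) :
    (∀ α' : Ordinal, α₀ < α' → α' < α →
        ∃ φ : Set.Ico α' α ≃o Set.Ico α₀ α,
          ∀ β : Set.Ico α' α, f β.1 = f (φ β).1) ↔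
      ((∃ κ : Ordinal, 0 < κ ∧ α = α₀ + ω ^ κ) ∧
        ∀ β : Ordinal, α₀ ≤ β → β < α → f β = f α₀) := by
  have hlt : α₀ < α := (lt_add_of_pos_right α₀ omega0_pos).trans_le h
  constructor
  · intro H
    refine ⟨?_, fun β h₁ h₂ => ?_⟩
    · obtain ⟨γ, rfl⟩ := exists_add_of_le hlt.le
      have hγ : ω ≤ γ := (add_le_add_iff_left α₀).1 h
      have hp : IsPrincipal (· + ·) γ := by
        refine isPrincipal_add_iff_add_left_eq_self.2 fun b hb => ?_
        rcases eq_zero_or_pos b with rfl | hb₀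
        · exact zero_add γ
        obtain ⟨δ, rfl⟩ := exists_add_of_le hb.le
        obtain ⟨φ, -⟩ := H (α₀ + b) (lt_add_of_pos_right α₀ hb₀) (add_lt_add_right hb α₀)
        rw [← add_assoc] at φ
        have e := (iioOrderIsoIcoAdd (α₀ + b) δ).trans φ
        rw [add_assoc] at e
        have hδ : δ = b + δ := eq_of_iio_orderIso (e.trans (iioOrderIsoIcoAdd α₀ (b + δ)).symm)
        exact congrArg (b + ·) hδ.symm
      rcases isPrincipal_add_iff_zero_or_omega0_opow.1 hp with rfl | ⟨κ, rfl⟩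
      · exact absurd hγ omega0_pos.not_ge
      · refine ⟨κ, pos_iff_ne_zero.2 ?_, rfl⟩
        rintro rfl
        exact one_lt_omega0.not_ge (by simpa using hγ)
    · rcases h₁.eq_or_lt with rfl | h₁
      · rfl
      · obtain ⟨φ, hφ⟩ := H β h₁ h₂
        rw [hφ ⟨β, le_rfl, h₂⟩, φ.apply_left_Ico h₂ hlt]
  · rintro ⟨⟨κ, -, rfl⟩, hf⟩ α' h₁ h₂
    obtain ⟨b, rfl⟩ := exists_add_of_le h₁.le
    have hb : b < ω ^ κ := (add_lt_add_iff_left α₀).1 h₂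
    have e := iioOrderIsoIcoAdd (α₀ + b) (ω ^ κ)
    rw [add_assoc, (isPrincipal_add_omega0_opow κ).add_eq_right hb] at e
    let φ := e.symm.trans (iioOrderIsoIcoAdd α₀ (ω ^ κ))
    refine ⟨φ, fun β => ?_⟩
    rw [hf β.1 (h₁.le.trans β.2.1) β.2.2, hf (φ β).1 (φ β).2.1 (φ β).2.2]
end
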